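/- Let L be an algebraic m-distributive multiplicative lattice. Let ℋ(Spec(L)) be the family of all compact saturated subsets of Spec(L) with the Zariski topology (a subset is saturated if it is an intersection of open sets), and let ℳ(L) be the collection of all saturated m-systems of L. Then the mappings φ: ℋ(Spec(L)) → ℳ(L), X ↦ S_X := {c ∈ C(L) : c ≰ p for all p ∈ X}, and ψ: ℳ(L) → ℋ(Spec(L)), S ↦ P(S) := ⋂_{s ∈ S} D(s), are mutually inverse, inclusion-reversing bijections. -/

import Mathlib

open CompleteLattice TopologicalSpace

variable {L : Type*} [CompleteLattice L]

/-- An element `p` of a multiplicative lattice is *prime* if `p ≠ 1` and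
`x·y ≤ p` implies `x ≤ p` or `y ≤ p`. -/
def PrimeElt (mul : L → L → L) (p : L) : Prop :=
  p ≠ ⊤ ∧ ∀ x y : L, mul x y ≤ p → x ≤ p ∨ y ≤ p

/-- The prime spectrum of a multiplicative lattice, as a type. -/
abbrev SpecL (mul : L → L → L) : Type _ := {p : L // PrimeElt mul p}

/-- The Zariski-closed set `V(x) = {p ∈ Spec L | x ≤ p}`. -/
def Vset (mul : L → L → L) (x : L) : Set (SpecL mul) := {p : SpecL mul | x ≤ p.1}

/-- The Zariski topology on the prime spectrum: the closed sets are the `V(x)`. -/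
instance (mul : L → L → L) : TopologicalSpace (SpecL mul) :=
  generateFrom {U : Set (SpecL mul) | ∃ x : L, U = (Vset mul x)ᶜ}

/-- An *m-system* in a multiplicative lattice: a nonempty set of compact elements such that
for all `x, y ∈ S` there is `z ∈ S` with `z ≤ x·y`. -/
def IsMSystem (mul : L → L → L) (S : Set L) : Prop :=
  S.Nonempty ∧ (∀ s ∈ S, IsCompactElement s) ∧
    ∀ x ∈ S, ∀ y ∈ S, ∃ z ∈ S, z ≤ mul x y

/-- A set `S` of compact elements is *saturated* if `x ∈ S`, `c` compact and `x ≤ c`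
imply `c ∈ S`. -/
def IsSaturated (S : Set L) : Prop :=
  ∀ x ∈ S, ∀ c : L, IsCompactElement c → x ≤ c → c ∈ S

theorem mem_compl_Vset {mul : L → L → L} {x : L} {p : SpecL mul} :
    p ∈ (Vset mul x)ᶜ ↔ ¬ x ≤ p.1 := Iff.rfl

theorem isOpen_compl_Vset (mul : L → L → L) (x : L) : IsOpen (Vset mul x)ᶜ :=
  isOpen_generateFrom_of_mem ⟨x, rfl⟩

theorem compl_Vset_sSup (mul : L → L → L) (s : Set L) :
    (Vset mul (sSup s))ᶜ = ⋃ x ∈ s, (Vset mul x)ᶜ := by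
  ext p
  simp [Vset]

theorem compl_Vset_inter {mul : L → L → L} (hmul : ∀ x y : L, mul x y ≤ x ⊓ y) (x y : L) :
    (Vset mul x)ᶜ ∩ (Vset mul y)ᶜ = (Vset mul (mul x y))ᶜ := by
  ext p
  simp only [Set.mem_inter_iff, mem_compl_Vset, ← not_or, not_iff_not]
  refine ⟨?_, p.2.2 x y⟩
  rintro (h | h)
  · exact ((hmul x y).trans inf_le_left).trans h
  · exact ((hmul x y).trans inf_le_right).trans h

theorem exists_eq_compl_Vset_of_isOpen {mul : L → L → L} (hmul : ∀ x y : L, mul x y ≤ x ⊓ y)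
    {U : Set (SpecL mul)} (hU : IsOpen U) : ∃ x : L, U = (Vset mul x)ᶜ := by
  induction hU with
  | basic s hs => exact hs
  | univ =>
    refine ⟨⊤, ?_⟩
    ext p
    simp [Vset, p.2.1]
  | inter s t _ _ hs ht =>
    obtain ⟨x, rfl⟩ := hs
    obtain ⟨y, rfl⟩ := ht
    exact ⟨mul x y, compl_Vset_inter hmul x y⟩
  | sUnion 𝒰 _ h =>
    choose f hf using h
    refine ⟨⨆ U : 𝒰, f U U.2, ?_⟩
    rw [iSup, compl_Vset_sSup, Set.biUnion_range, Set.sUnion_eq_iUnion]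
    exact Set.iUnion_congr fun U => hf U U.2

/-- If a compact set of primes is contained in `D(x)`, it is contained in `D(c)` for some
compact element `c ≤ x`. -/
theorem exists_isCompactElement_le_of_isCompact {mul : L → L → L}
    (halg : ∀ x : L, ∃ s : Set L, (∀ c ∈ s, IsCompactElement c) ∧ x = sSup s)
    {K : Set (SpecL mul)} (hK : IsCompact K) {x : L} (hx : ∀ p ∈ K, ¬ x ≤ p.1) :
    ∃ c, IsCompactElement c ∧ (∀ p ∈ K, ¬ c ≤ p.1) ∧ c ≤ x := by
  obtain ⟨s, hs, rfl⟩ := halg x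
  have hcov : K ⊆ ⋃ c : s, (Vset mul c.1)ᶜ := by
    have h : K ⊆ (Vset mul (sSup s))ᶜ := hx
    rwa [compl_Vset_sSup, Set.biUnion_eq_iUnion] at h
  obtain ⟨t, ht⟩ := hK.elim_finite_subcover _ (fun c : s => isOpen_compl_Vset mul c.1) hcov
  refine ⟨t.sup Subtype.val, isCompactElement_finsetSup t fun c _ => hs c c.2, fun p hp hle => ?_,
    Finset.sup_le fun c _ => le_sSup c.2⟩
  obtain ⟨c, hct, hc⟩ := Set.mem_iUnion₂.1 (ht hp)
  exact hc ((Finset.le_sup hct).trans hle)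

/-- An element lying above no member of an m-system `S` lies below a prime that is above no
member of `S`. -/
theorem IsMSystem.exists_prime_ge {mul : L → L → L}
    (hmul : ∀ x y : L, mul x y ≤ x ⊓ y)
    (hdistl : ∀ x y z : L, mul (x ⊔ y) z = mul x z ⊔ mul y z)
    (hdistr : ∀ x y z : L, mul x (y ⊔ z) = mul x y ⊔ mul x z)
    {S : Set L} (hS : IsMSystem mul S) {x : L} (hx : ∀ s ∈ S, ¬ s ≤ x) :
    ∃ p : SpecL mul, x ≤ p.1 ∧ ∀ s ∈ S, ¬ s ≤ p.1 := by
  obtain ⟨⟨s₀, hs₀⟩, hcpt, hmulS⟩ := hS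
  obtain ⟨p, hxp, hp⟩ := zorn_le_nonempty₀ {y : L | ∀ s ∈ S, ¬ s ≤ y} (fun c hc hchain y hy => by
    refine ⟨sSup c, fun s hs hle => ?_, fun z hz => le_sSup hz⟩
    obtain ⟨z, hz, hsz⟩ := hcpt s hs c _ ⟨y, hy⟩ hchain.directedOn (_root_.isLUB_sSup c) hle
    exact hc hz s hs hsz) x hx
  have hlarge : ∀ a, ¬ a ≤ p → ∃ s ∈ S, s ≤ p ⊔ a := fun a ha => by
    by_contra! h
    exact ha (le_sup_right.trans (hp.2 h le_sup_left))
  refine ⟨⟨p, fun h => hp.1 s₀ hs₀ (h ▸ le_top), fun a b hab => ?_⟩, hxp, hp.1⟩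
  by_contra! h
  obtain ⟨s, hs, hsa⟩ := hlarge a h.1
  obtain ⟨t, ht, htb⟩ := hlarge b h.2
  obtain ⟨z, hz, hzst⟩ := hmulS s hs t ht
  have hleft : mul s t ≤ mul (p ⊔ a) t := by
    rw [← sup_eq_right.2 hsa, hdistl]
    exact le_sup_left
  have hright : mul (p ⊔ a) t ≤ mul (p ⊔ a) (p ⊔ b) := by
    rw [← sup_eq_right.2 htb, hdistr]
    exact le_sup_left
  refine hp.1 z hz (hzst.trans (hleft.trans (hright.trans ?_)))
  rw [hdistr, hdistl p a b]
  exact sup_le ((hmul _ _).trans inf_le_right) (sup_le ((hmul _ _).trans inf_le_left) hab)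

/-- The maps `φ : K ↦ S_K` and `ψ : S ↦ P(S)` are mutually inverse inclusion-reversing
bijections between the compact saturated subsets of `Spec L` (Zariski topology) and the
saturated m-systems of `L`. -/
theorem phi_psi_bijections (mul : L → L → L)
    (hmul : ∀ x y : L, mul x y ≤ x ⊓ y)
    (hdistl : ∀ x y z : L, mul (x ⊔ y) z = mul x z ⊔ mul y z)
    (hdistr : ∀ x y z : L, mul x (y ⊔ z) = mul x y ⊔ mul x z)
    (halg : ∀ x : L, ∃ s : Set L, (∀ c ∈ s, IsCompactElement c) ∧ x = sSup s) :
    let H : Set (Set (SpecL mul)) :=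
      {K | IsCompact K ∧ ∃ 𝒰 : Set (Set (SpecL mul)), (∀ U ∈ 𝒰, IsOpen U) ∧ K = ⋂₀ 𝒰}
    let M : Set (Set L) := {S | IsMSystem mul S ∧ IsSaturated S}
    let φ : Set (SpecL mul) → Set L :=
      fun K => {c : L | IsCompactElement c ∧ ∀ p ∈ K, ¬ c ≤ p.1}
    let ψ : Set L → Set (SpecL mul) := fun S => ⋂ s ∈ S, (Vset mul s)ᶜ
    (∀ K ∈ H, φ K ∈ M) ∧ (∀ S ∈ M, ψ S ∈ H) ∧
      (∀ K ∈ H, ψ (φ K) = K) ∧ (∀ S ∈ M, φ (ψ S) = S) ∧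
      (∀ K K' : Set (SpecL mul), K ∈ H → K' ∈ H → K ⊆ K' → φ K' ⊆ φ K) ∧
      (∀ S S' : Set L, S ∈ M → S' ∈ M → S ⊆ S' → ψ S' ⊆ ψ S) := by
  intro H M φ ψ
  have mem_ψ : ∀ {S : Set L} {p : SpecL mul}, p ∈ ψ S ↔ ∀ s ∈ S, ¬ s ≤ p.1 := fun {S p} =>
    Set.mem_iInter₂
  have exists_le : ∀ S ∈ M, ∀ x, (∀ p ∈ ψ S, ¬ x ≤ p.1) → ∃ s ∈ S, s ≤ x := by
    intro S hS x hx
    by_contra! h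
    obtain ⟨p, hxp, hp⟩ := hS.1.exists_prime_ge hmul hdistl hdistr h
    exact hx p (mem_ψ.2 hp) hxp
  refine ⟨fun K hK => ⟨⟨?_, fun c hc => hc.1, ?_⟩, ?_⟩, fun S hS => ⟨?_, ?_⟩, fun K hK => ?_,
    fun S hS => ?_, fun K K' _ _ h c hc => ⟨hc.1, fun p hp => hc.2 p (h hp)⟩,
    fun S S' _ _ h => Set.biInter_subset_biInter_left h⟩
  · obtain ⟨c, hc, hcK, -⟩ := exists_isCompactElement_le_of_isCompact halg hK.1
      (x := ⊤) fun p _ h => p.2.1 (top_le_iff.1 h)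
    exact ⟨c, hc, hcK⟩
  · intro x hx y hy
    obtain ⟨c, hc, hcK, hle⟩ := exists_isCompactElement_le_of_isCompact halg hK.1
      (x := mul x y) fun p hp h => (p.2.2 x y h).elim (hx.2 p hp) (hy.2 p hp)
    exact ⟨c, ⟨hc, hcK⟩, hle⟩
  · exact fun x hx c hc hxc => ⟨hc, fun p hp h => hx.2 p hp (hxc.trans h)⟩
  · refine isCompact_of_finite_subcover fun {ι} U hU hcov => ?_
    choose x hx using fun i => exists_eq_compl_Vset_of_isOpen hmul (hU i)
    obtain ⟨s, hs, hle⟩ := exists_le S hS (⨆ i, x i) fun p hp h => by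
      obtain ⟨i, hi⟩ := Set.mem_iUnion.1 (hcov hp)
      rw [hx i] at hi
      exact hi ((le_iSup x i).trans h)
    obtain ⟨t, ht⟩ := IsCompactElement.exists_finset_of_le_iSup L (hS.1.2.1 s hs) x hle
    refine ⟨t, fun p hp => ?_⟩
    by_contra hnot
    refine mem_ψ.1 hp s hs (ht.trans (iSup₂_le fun i hi => ?_))
    by_contra hxi
    refine hnot (Set.mem_iUnion₂.2 ⟨i, hi, ?_⟩)
    rw [hx i]
    exact hxi
  · refine ⟨(fun s => (Vset mul s)ᶜ) '' S, ?_, (Set.sInter_image _ S).symm⟩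
    rintro _ ⟨s, -, rfl⟩
    exact isOpen_compl_Vset mul s
  · refine Set.Subset.antisymm (fun p hp => ?_) fun p hp => mem_ψ.2 fun c hc => hc.2 p hp
    obtain ⟨hK, 𝒰, h𝒰, rfl⟩ := hK
    intro U hU
    obtain ⟨x, rfl⟩ := exists_eq_compl_Vset_of_isOpen hmul (h𝒰 U hU)
    obtain ⟨c, hc, hcK, hle⟩ := exists_isCompactElement_le_of_isCompact halg hK
      (x := x) fun q hq => hq _ hU
    exact fun hxp => mem_ψ.1 hp c ⟨hc, hcK⟩ (hle.trans hxp)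
  · refine Set.Subset.antisymm (fun c hc => ?_) fun c hc =>
      ⟨hS.1.2.1 c hc, fun p hp => mem_ψ.1 hp c hc⟩
    obtain ⟨s, hs, hsc⟩ := exists_le S hS c hc.2
    exact hS.2 s hs c hc.1 hsc
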